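/- arXiv:math/0103085 — 6 statements merged into one kernel-verified Lean document; each statement's English description precedes it below -/
import Mathlib

section
/- Let A : Matrix (Fin n) (Fin n) R be a matrix over R = MvPolynomial (Fin n) ℂ with entries a_{ik} = A i k, let δ_i = Σ_k a_{ik} ∂_k be the associated derivations, and put f = det A. Suppose that for all i, j there is a family α^{ij} : Fin n → R with ⁅δ_i, δ_j⁆ = Σ_k α^{ij}_k δ_k as derivations. Then for every index i, δ_i(f) = f · ( Σ_k ∂_k(a_{ik}) + Σ_{k ≠ i} α^{ik}_k ). -/
open MvPolynomial Matrix

/-- The vector field `δ_i = Σ_k a_{ik} ∂_k` associated to the `i`-th row of `A`. -/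
noncomputable def rowDerivation {n : ℕ}
    (A : Matrix (Fin n) (Fin n) (MvPolynomial (Fin n) ℂ)) (i : Fin n) :
    Derivation ℂ (MvPolynomial (Fin n) ℂ) (MvPolynomial (Fin n) ℂ) :=
  ∑ k : Fin n, A i k • pderiv k

theorem Derivation.leibniz_finset_prod {S R ι : Type*} [CommRing S] [CommRing R] [Algebra S R]
    [DecidableEq ι] (D : Derivation S R R) (s : Finset ι) (f : ι → R) :
    D (∏ i ∈ s, f i) = ∑ i ∈ s, (∏ j ∈ s.erase i, f j) * D (f i) := by
  induction s using Finset.induction_on with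
  | empty => simp
  | insert a s ha ih =>
    rw [Finset.prod_insert ha, D.leibniz, ih, Finset.sum_insert ha, Finset.erase_insert ha,
      smul_eq_mul, smul_eq_mul, Finset.mul_sum, add_comm]
    congr 1
    refine Finset.sum_congr rfl fun i hi => ?_
    have hai : a ≠ i := fun h => ha (h ▸ hi)
    rw [Finset.erase_insert_of_ne hai, Finset.prod_insert (by simp [ha]), mul_assoc]

/-- Jacobi's formula for a derivation, in terms of replacing one row at a time. -/
theorem Derivation.map_det_eq_sum_updateRow {S R m : Type*} [CommRing S] [CommRing R]
    [Algebra S R] [Fintype m] [DecidableEq m] (D : Derivation S R R) (A : Matrix m m R) :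
    D A.det = ∑ j, (A.updateRow j fun l => D (A j l)).det := by
  simp_rw [← Matrix.det_transpose (Matrix.updateRow _ _ _), ← Matrix.det_transpose A,
    Matrix.det_apply, map_sum, Matrix.transpose_apply]
  rw [Finset.sum_comm]
  refine Finset.sum_congr rfl fun σ _ => ?_
  rw [← Finset.smul_sum, Units.smul_def, Units.smul_def, map_zsmul, D.leibniz_finset_prod]
  congr 1
  refine Finset.sum_congr rfl fun j _ => ?_
  rw [← Finset.prod_erase_mul _ _ (Finset.mem_univ j), Matrix.updateRow_self]
  congr 1
  refine Finset.prod_congr rfl fun k hk => ?_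
  rw [Matrix.updateRow_ne (Finset.ne_of_mem_erase hk)]

/-- Jacobi's formula for a derivation. -/
theorem Derivation.map_det {S R m : Type*} [CommRing S] [CommRing R]
    [Algebra S R] [Fintype m] [DecidableEq m] (D : Derivation S R R) (A : Matrix m m R) :
    D A.det = (A.map D * A.adjugate).trace := by
  rw [D.map_det_eq_sum_updateRow, Matrix.trace]
  refine Finset.sum_congr rfl fun j _ => ?_
  rw [← Matrix.cramer_transpose_apply, Matrix.cramer_eq_adjugate_mulVec,
    ← Matrix.adjugate_transpose, Matrix.mulVec_transpose]
  rfl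

theorem rowDerivation_apply {n : ℕ} (A : Matrix (Fin n) (Fin n) (MvPolynomial (Fin n) ℂ))
    (i : Fin n) (p : MvPolynomial (Fin n) ℂ) :
    rowDerivation A i p = ∑ k, A i k * pderiv k p := by
  rw [rowDerivation, ← Derivation.coeFnAddMonoidHom_apply, map_sum, Finset.sum_apply]
  rfl

theorem rowDerivation_X {n : ℕ} (A : Matrix (Fin n) (Fin n) (MvPolynomial (Fin n) ℂ))
    (i l : Fin n) : rowDerivation A i (X l) = A i l := by
  simp [rowDerivation_apply, pderiv_X, Pi.single_apply]

/-- If `⁅δ_i, δ_j⁆ = Σ_k α^{ij}_k δ_k` for all `i, j`, then with `f = det A`,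
`δ_i(f) = f · (Σ_k ∂_k(a_{ik}) + Σ_{k ≠ i} α^{ik}_k)` for every `i`. -/
theorem rowDerivation_det {n : ℕ}
    (A : Matrix (Fin n) (Fin n) (MvPolynomial (Fin n) ℂ))
    (α : Fin n → Fin n → Fin n → MvPolynomial (Fin n) ℂ)
    (hα : ∀ i j : Fin n,
      ⁅rowDerivation A i, rowDerivation A j⁆
        = ∑ k : Fin n, α i j k • rowDerivation A k) :
    ∀ i : Fin n,
      rowDerivation A i A.det
        = A.det * (∑ k : Fin n, pderiv k (A i k)
            + ∑ k ∈ Finset.univ.erase i, α i k k) := by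
  intro i
  have hbracket (j l : Fin n) : rowDerivation A i (A j l) - rowDerivation A j (A i l)
      = ∑ k, α i j k * A k l := by
    have h := DFunLike.congr_fun (hα i j) (X l)
    rw [Derivation.commutator_apply, rowDerivation_X, rowDerivation_X,
      ← Derivation.coeFnAddMonoidHom_apply (∑ k, _), map_sum, Finset.sum_apply] at h
    simpa [rowDerivation_X] using h
  let B : Matrix (Fin n) (Fin n) (MvPolynomial (Fin n) ℂ) := Matrix.of (α i)
  let J : Matrix (Fin n) (Fin n) (MvPolynomial (Fin n) ℂ) :=
    Matrix.of fun k l => pderiv k (A i l)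
  have hmap : A.map (rowDerivation A i) = B * A + A * J := by
    ext1 j l
    rw [Matrix.map_apply, Matrix.add_apply, Matrix.mul_apply, Matrix.mul_apply]
    exact (sub_eq_iff_eq_add.mp (hbracket j l)).trans
      (congrArg _ (rowDerivation_apply A j (A i l)))
  have hdiag : A.det * α i i i = 0 := by
    have h0 : α i i ᵥ* A = 0 := by
      ext1 l
      exact (hbracket i l).symm.trans (sub_self _)
    have h1 := congrArg (· ᵥ* A.adjugate) h0
    simp only [Matrix.vecMul_vecMul, Matrix.mul_adjugate, Matrix.zero_vecMul,
      Matrix.vecMul_smul, Matrix.vecMul_one] at h1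
    exact congrFun h1 i
  have htrace : rowDerivation A i A.det = A.det * (J.trace + B.trace) := by
    rw [Derivation.map_det, hmap, Matrix.add_mul, Matrix.trace_add, Matrix.mul_assoc,
      Matrix.mul_adjugate, Matrix.trace_mul_comm (A * J), ← Matrix.mul_assoc,
      Matrix.adjugate_mul]
    simp only [Matrix.mul_smul, Matrix.smul_mul, Matrix.mul_one, Matrix.one_mul,
      Matrix.trace_smul, smul_eq_mul]
    ring
  have hB : B.trace = α i i i + ∑ k ∈ Finset.univ.erase i, α i k k :=
    (Finset.add_sum_erase _ _ (Finset.mem_univ i)).symm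
  have hJ : J.trace = ∑ k, pderiv k (A i k) := rfl
  rw [htrace, hB, hJ]
  linear_combination hdiag
end

section
/- (Logarithmic derivations of a normal crossing divisor.) Let R = MvPolynomial (Fin n) ℂ, let t ≤ n, and let f = Π_{i < t} X_i be the product of the first t variables. Let δ = Σ_k c_k ∂_k be a derivation of R with polynomial coefficients c : Fin n → R. Then δ(f) belongs to the ideal generated by f if and only if X_i divides c_i for every i < t. -/
open MvPolynomial

theorem Derivation.apply_prod_eq_sum {R A ι : Type*} [CommSemiring R] [CommSemiring A]
    [Algebra R A] [DecidableEq ι] (D : Derivation R A A) (s : Finset ι) (g : ι → A) :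
    D (∏ i ∈ s, g i) = ∑ i ∈ s, D (g i) * ∏ j ∈ s.erase i, g j := by
  induction s using Finset.induction_on with
  | empty => simp
  | insert a s ha ih =>
    rw [Finset.prod_insert ha, Finset.sum_insert ha, D.leibniz, ih, Finset.erase_insert ha,
      smul_eq_mul, smul_eq_mul, Finset.mul_sum, add_comm, mul_comm]
    congr 1
    refine Finset.sum_congr rfl fun i hi => ?_
    have hai : a ≠ i := fun h => ha (h ▸ hi)
    rw [Finset.erase_insert_of_ne hai, Finset.prod_insert (by simp [ha])]
    ring

theorem MvPolynomial.sum_smul_pderiv_apply_X {R σ : Type*} [CommRing R] [Fintype σ]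
    (c : σ → MvPolynomial σ R) (i : σ) :
    (∑ k, c k • pderiv k : Derivation R (MvPolynomial σ R) (MvPolynomial σ R)) (X i) = c i := by
  classical
  have h : (∑ k, c k • pderiv k : Derivation R (MvPolynomial σ R) (MvPolynomial σ R)) (X i)
      = ∑ k, (c k • pderiv k : Derivation R (MvPolynomial σ R) (MvPolynomial σ R)) (X i) := by
    rw [← Derivation.coeFnAddMonoidHom_apply, map_sum, Finset.sum_apply]
    rfl
  simp [h, pderiv_X, Pi.single_apply]

/-- For a derivation `D` and pairwise non-associated primes `p i`, the ideal generated by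
`∏ i ∈ s, p i` contains the image of that product iff `p i ∣ D (p i)` for all `i ∈ s`. -/
theorem Derivation.prod_dvd_apply_prod_iff {R A ι : Type*} [CommRing R] [CommRing A]
    [Algebra R A] (D : Derivation R A A) (s : Finset ι) (p : ι → A)
    (hp : ∀ i ∈ s, Prime (p i)) (hne : ∀ i ∈ s, ∀ j ∈ s, p i ∣ p j → i = j) :
    ∏ i ∈ s, p i ∣ D (∏ i ∈ s, p i) ↔ ∀ i ∈ s, p i ∣ D (p i) := by
  classical
  rw [D.apply_prod_eq_sum]
  constructor
  · intro h i hi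
    have hsum := (Finset.dvd_prod_of_mem p hi).trans h
    rw [← Finset.add_sum_erase s _ hi] at hsum
    have hrest : p i ∣ ∑ k ∈ s.erase i, D (p k) * ∏ j ∈ s.erase k, p j :=
      Finset.dvd_sum fun k hk => Dvd.dvd.mul_left (Finset.dvd_prod_of_mem p
        (Finset.mem_erase.2 ⟨(Finset.ne_of_mem_erase hk).symm, hi⟩)) _
    refine ((hp i hi).dvd_or_dvd ((dvd_add_left hrest).1 hsum)).resolve_right fun hdvd => ?_
    obtain ⟨j, hj, hij⟩ := ((hp i hi).dvd_finsetProd_iff p).1 hdvd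
    exact Finset.ne_of_mem_erase hj (hne i hi j (Finset.mem_of_mem_erase hj) hij).symm
  · intro h
    refine Finset.dvd_sum fun i hi => ?_
    rw [← Finset.mul_prod_erase s p hi]
    exact mul_dvd_mul_right (h i hi) _

/-- Logarithmic derivations of a normal crossing divisor: for
`f = Π_{i < t} X_i` and `δ = Σ_k c_k ∂_k`, one has `δ(f) ∈ (f)` iff
`X_i ∣ c_i` for all `i < t`. -/
theorem logarithmic_iff_normal_crossing {n t : ℕ} (ht : t ≤ n)
    (c : Fin n → MvPolynomial (Fin n) ℂ) :
    ((∑ k : Fin n, c k • pderiv k :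
        Derivation ℂ (MvPolynomial (Fin n) ℂ) (MvPolynomial (Fin n) ℂ))
        (∏ i ∈ Finset.univ.filter (fun i : Fin n => (i : ℕ) < t), X i)
      ∈ Ideal.span {∏ i ∈ Finset.univ.filter (fun i : Fin n => (i : ℕ) < t), X i})
    ↔ ∀ i : Fin n, (i : ℕ) < t → X i ∣ c i := by
  rw [Ideal.mem_span_singleton, Derivation.prod_dvd_apply_prod_iff _ _ _
    (fun i _ => X_prime) (fun i _ j _ h => by simpa using h)]
  simp [sum_smul_pderiv_apply_X]
end

section
/- Let f = y(x²+y)(x²z+y) in ℚ[x,y,z] and consider the derivations δ₁ = (1/2)x ∂x + y ∂y, δ₂ = (x²z+y) ∂z, δ₃ = ((1/2)x² + (1/2)y) ∂x + (xz² − xz) ∂z. Then δ₁(f) = 3f, δ₂(f) = x²·f, and δ₃(f) = (xz + x)·f; in particular each δ_i is a logarithmic derivation for the surface f = 0. Equivalently, one has the syzygies −3f + (1/2)x·f_x + y·f_y = 0, −x²·f + (x²z+y)·f_z = 0, and (−xz − x)·f + ((1/2)x² + (1/2)y)·f_x + (xz² − xz)·f_z = 0 among f and its partial derivatives f_x, f_y,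 f_z. -/
open MvPolynomial

namespace FreeSurfaceExample

noncomputable abbrev R := MvPolynomial (Fin 3) ℚ

noncomputable def x : R := X 0
noncomputable def y : R := X 1
noncomputable def z : R := X 2

/-- The surface `f = y(x²+y)(x²z+y)`. -/
noncomputable def f : R := y * (x ^ 2 + y) * (x ^ 2 * z + y)

/-- `δ₁ = (1/2)x ∂x + y ∂y`. -/
noncomputable def δ₁ : Derivation ℚ R R :=
  (C (1 / 2 : ℚ) * x) • pderiv (0 : Fin 3) + y • pderiv (1 : Fin 3)

/-- `δ₂ = (x²z + y) ∂z`. -/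
noncomputable def δ₂ : Derivation ℚ R R :=
  (x ^ 2 * z + y) • pderiv (2 : Fin 3)

/-- `δ₃ = ((1/2)x² + (1/2)y) ∂x + (xz² − xz) ∂z`. -/
noncomputable def δ₃ : Derivation ℚ R R :=
  (C (1 / 2 : ℚ) * x ^ 2 + C (1 / 2 : ℚ) * y) • pderiv (0 : Fin 3)
    + (x * z ^ 2 - x * z) • pderiv (2 : Fin 3)

theorem two_mul_C_half : (2 : R) * C (1 / 2 : ℚ) = 1 := by
  rw [← map_ofNat (C : ℚ →+* R) 2, ← C_mul]
  norm_num

theorem pderiv_zero_f :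
    pderiv (0 : Fin 3) f = y * (2 * x) * (x ^ 2 * z + y) + y * (x ^ 2 + y) * (2 * x * z) := by
  simp [f, x, y, z, Derivation.leibniz, Derivation.leibniz_pow, pderiv_X]
  ring

theorem pderiv_one_f :
    pderiv (1 : Fin 3) f =
      (x ^ 2 + y) * (x ^ 2 * z + y) + y * (x ^ 2 * z + y) + y * (x ^ 2 + y) := by
  simp [f, x, y, z, Derivation.leibniz, Derivation.leibniz_pow, pderiv_X]
  ring

theorem pderiv_two_f : pderiv (2 : Fin 3) f = y * (x ^ 2 + y) * x ^ 2 := by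
  simp [f, x, y, z, Derivation.leibniz, Derivation.leibniz_pow, pderiv_X]

theorem δ₁_f : δ₁ f = 3 * f := by
  simp only [δ₁, Derivation.add_apply, Derivation.smul_apply, smul_eq_mul, pderiv_zero_f,
    pderiv_one_f]
  rw [f]
  linear_combination
    (x * (y * x * (x ^ 2 * z + y) + y * (x ^ 2 + y) * (x * z))) * two_mul_C_half

theorem δ₂_f : δ₂ f = x ^ 2 * f := by
  simp only [δ₂, Derivation.smul_apply, smul_eq_mul, pderiv_two_f]
  rw [f]
  ring

theorem δ₃_f : δ₃ f = (x * z + x) * f := by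
  simp only [δ₃, Derivation.add_apply, Derivation.smul_apply, smul_eq_mul, pderiv_zero_f,
    pderiv_two_f]
  rw [f]
  linear_combination
    ((x ^ 2 + y) * (y * x * (x ^ 2 * z + y) + y * (x ^ 2 + y) * (x * z))) * two_mul_C_half

/-- `δ₁, δ₂, δ₃` are logarithmic derivations of `f = y(x²+y)(x²z+y)`:
`δ₁(f) = 3f`, `δ₂(f) = x²f`, `δ₃(f) = (xz+x)f`, each `δᵢ(f)` lies in the
ideal `(f)`, and the corresponding syzygies among `f, f_x, f_y, f_z` hold. -/
theorem logarithmic_derivations_example :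
    δ₁ f = 3 * f ∧ δ₂ f = x ^ 2 * f ∧ δ₃ f = (x * z + x) * f
    ∧ δ₁ f ∈ Ideal.span {f} ∧ δ₂ f ∈ Ideal.span {f} ∧ δ₃ f ∈ Ideal.span {f}
    ∧ -3 * f + C (1 / 2 : ℚ) * x * pderiv (0 : Fin 3) f
        + y * pderiv (1 : Fin 3) f = 0
    ∧ -x ^ 2 * f + (x ^ 2 * z + y) * pderiv (2 : Fin 3) f = 0
    ∧ (-(x * z) - x) * f
        + (C (1 / 2 : ℚ) * x ^ 2 + C (1 / 2 : ℚ) * y) * pderiv (0 : Fin 3) f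
        + (x * z ^ 2 - x * z) * pderiv (2 : Fin 3) f = 0 := by
  have h₁ := δ₁_f
  have h₂ := δ₂_f
  have h₃ := δ₃_f
  refine ⟨h₁, h₂, h₃, Ideal.mem_span_singleton.2 (h₁ ▸ dvd_mul_left f _),
    Ideal.mem_span_singleton.2 (h₂ ▸ dvd_mul_left f _),
    Ideal.mem_span_singleton.2 (h₃ ▸ dvd_mul_left f _), ?_, ?_, ?_⟩
  · simp only [δ₁, Derivation.add_apply, Derivation.smul_apply, smul_eq_mul] at h₁
    linear_combination h₁
  · simp only [δ₂, Derivation.smul_apply, smul_eq_mul] at h₂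
    linear_combination h₂
  · simp only [δ₃, Derivation.add_apply, Derivation.smul_apply, smul_eq_mul] at h₃
    linear_combination h₃

end FreeSurfaceExample
end

section
/- In the polynomial ring S = ℚ[x, y, z, ξ, η, ζ] in six variables, let σ₁ = (1/2)xξ + yη and σ₂ = (x²z + y)ζ. Then the polynomial g = yzη²ζ + (1/4)ξ²ζ does NOT belong to the ideal generated by σ₁ and σ₂. -/
open MvPolynomial

namespace SymbolsExample

noncomputable abbrev S := MvPolynomial (Fin 6) ℚ

noncomputable def x : S := X 0
noncomputable def y : S := X 1
noncomputable def z : S := X 2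
noncomputable def ξ : S := X 3
noncomputable def η : S := X 4
noncomputable def ζ : S := X 5

/-- Principal symbol of `δ₁ = (1/2)x ∂x + y ∂y`. -/
noncomputable def σ₁ : S := C (1 / 2 : ℚ) * x * ξ + y * η

/-- Principal symbol of `δ₂ = (x²z+y) ∂z`. -/
noncomputable def σ₂ : S := (x ^ 2 * z + y) * ζ

/-- `g = yzη²ζ + (1/4)ξ²ζ` does not lie in the ideal `(σ₁, σ₂)`. -/
theorem g_not_mem_span :
    y * z * η ^ 2 * ζ + C (1 / 4 : ℚ) * ξ ^ 2 * ζ ∉ Ideal.span {σ₁, σ₂} := by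
  intro h
  -- Both symbols vanish at the point `(0, 0, 0, 1, 0, 1)`, where `g` takes the value `1 / 4`.
  let p : Fin 6 → ℚ := ![0, 0, 0, 1, 0, 1]
  have hle : Ideal.span {σ₁, σ₂} ≤ RingHom.ker (eval p) := by
    rw [Ideal.span_le]
    rintro f (rfl | rfl) <;> simp [RingHom.mem_ker, σ₁, σ₂, x, y, z, ξ, η, ζ, p]
  have hg := RingHom.mem_ker.mp (hle h)
  simp [y, z, ξ, η, ζ, p] at hg

end SymbolsExample
end

section
/- In the polynomial ring S = ℚ[x, y, z, ξ, η, ζ] in six variables, let σ₁ = (1/2)xξ + yη, σ₂ = (x²z + y)ζ, and σ₃ = ((1/2)x² + (1/2)y)ξ + (xz² − xz)ζ. Then the product g·σ₃, where g = yzη²ζ + (1/4)ξ²ζ, belongs to the ideal generated by σ₁ and σ₂. -/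
open MvPolynomial

namespace SymbolsExample

/-- Principal symbol of `δ₃ = ((1/2)x² + (1/2)y) ∂x + (xz² − xz) ∂z`. -/
noncomputable def σ₃ : S :=
  (C (1 / 2 : ℚ) * x ^ 2 + C (1 / 2 : ℚ) * y) * ξ + (x * z ^ 2 - x * z) * ζ

/-- The product `g·σ₃`, with `g = yzη²ζ + (1/4)ξ²ζ`, lies in the ideal `(σ₁, σ₂)`. -/
theorem g_mul_σ₃_mem_span :
    (y * z * η ^ 2 * ζ + C (1 / 4 : ℚ) * ξ ^ 2 * ζ) * σ₃ ∈ Ideal.span {σ₁, σ₂} := by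
  have hC : (C (1 / 4 : ℚ) : S) = C (1 / 2 : ℚ) * C (1 / 2 : ℚ) := by
    rw [← C_mul]; norm_num
  rw [Ideal.mem_span_pair]
  refine ⟨(C (1 / 2 : ℚ) * x * ξ + (z ^ 2 - z) * ζ) * (x * z * η * ζ + C (1 / 2 : ℚ) * ξ * ζ)
      + C (1 / 2 : ℚ) * ξ * z * ζ * (y * η - C (1 / 2 : ℚ) * x * ξ),
    -(C (1 / 2 : ℚ) * x * ξ + (z ^ 2 - z) * ζ) * (C (1 / 2 : ℚ) * ξ * η)
      + C (1 / 2 : ℚ) * C (1 / 4 : ℚ) * ξ ^ 3, ?_⟩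
  rw [hC, σ₁, σ₂, σ₃]
  generalize (C (1 / 2 : ℚ) : S) = h
  ring

end SymbolsExample
end

section
/- In the polynomial ring S = ℚ[x, y, z, ξ, η, ζ] in six variables, the sequence σ₁ = (1/2)xξ + yη, σ₂ = (x²z + y)ζ, σ₃ = ((1/2)x² + (1/2)y)ξ + (xz² − xz)ζ is NOT a regular sequence on S: the element σ₃ is a zero divisor on S/(σ₁, σ₂), since g = yzη²ζ + (1/4)ξ²ζ satisfies g ∉ (σ₁, σ₂) while g·σ₃ ∈ (σ₁, σ₂). -/
open MvPolynomial

namespace SymbolsExample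

/-- `g = yzη²ζ + (1/4)ξ²ζ`. -/
noncomputable def g : S := y * z * η ^ 2 * ζ + C (1 / 4 : ℚ) * ξ ^ 2 * ζ

theorem g_notMem_span : g ∉ Ideal.span {σ₁, σ₂} := by
  intro h
  obtain ⟨a, b, hab⟩ := Ideal.mem_span_pair.1 h
  have := congrArg (eval (![0, 0, 0, 1, 0, 1] : Fin 6 → ℚ)) hab
  simp [g, σ₁, σ₂, x, y, z, ξ, η, ζ] at this

theorem g_mul_σ₃_mem_span_s12 : g * σ₃ ∈ Ideal.span {σ₁, σ₂} := by
  have hC : (C (1 / 4 : ℚ) : S) = C (1 / 2) ^ 2 := by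
    rw [← C_pow]
    norm_num
  refine Ideal.mem_span_pair.2
    ⟨(C (1 / 2) * ξ * x * (1 - z) + z * (z - 1) * ζ) * (C (1 / 2) * ξ + x * z * η) * ζ,
      C (1 / 2) * ξ * (y * z * η ^ 2 + C (1 / 2) ^ 2 * ξ ^ 2) +
        (C (1 / 2) * ξ * x * (1 - z) + z * (z - 1) * ζ) *
          (x * z * η ^ 2 - (C (1 / 2) * ξ + x * z * η) * η), ?_⟩
  rw [g, hC, σ₁, σ₂, σ₃]
  ring

/-- The sequence `σ₁, σ₂, σ₃` is not a regular sequence on `S`: the witness `g`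
satisfies `g ∉ (σ₁, σ₂)` while `g·σ₃ ∈ (σ₁, σ₂)`, so `σ₃` is a zero divisor on
`S/(σ₁, σ₂)`.  (The surface `y(x²+y)(x²z+y) = 0` is not Koszul free.) -/
theorem not_regular_sequence :
    ¬ RingTheory.Sequence.IsRegular S [σ₁, σ₂, σ₃]
    ∧ g ∉ Ideal.span {σ₁, σ₂}
    ∧ g * σ₃ ∈ Ideal.span {σ₁, σ₂} := by
  refine ⟨fun h => g_notMem_span ?_, g_notMem_span, g_mul_σ₃_mem_span_s12⟩
  have hreg := h.regular_mod_prev 2 (by simp)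
  have hspan : (Ideal.ofList (List.take 2 [σ₁, σ₂, σ₃]) • ⊤ : Submodule S S) =
      Ideal.span {σ₁, σ₂} := by
    simp [Ideal.span_insert]
  rw [hspan] at hreg
  refine mem_of_isSMulRegular_quotient_of_smul_mem hreg (?_ : σ₃ • g ∈ _)
  simpa [mul_comm] using g_mul_σ₃_mem_span_s12

end SymbolsExample
end
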